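/- Let d ∈ ℕ and η > 0 be a real number. For every ε > 0 there exists a C^∞ function ψ : ℝ → ℝ such that ψ(ρ) = 0 for all ρ ≥ η², ψ'(ρ) ≥ −1 and ψ''(ρ) ≥ 0 for all ρ ≥ 0, and ∫₀^η [1 − (1 + ψ'(r²))^{d+1}]·(2d+2)·r^{2d+1} dr ≥ η^{2d+2} − ε. -/

import Mathlib

/-- Approximation step in the proof of Theorem 6.1: for every `ε > 0` there is
a `C^∞` function `ψ : ℝ → ℝ`, vanishing on `[η², ∞)`, with `ψ' ≥ -1` and
`ψ'' ≥ 0` on `[0, ∞)`, whose integral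
`∫₀^η (1 - (1 + ψ'(r²))^(d+1)) * (2d+2) * r^(2d+1) dr` is at least
`η^(2d+2) - ε`. -/
theorem integral_bound_approx
    (d : ℕ) (η : ℝ) (hη : 0 < η) :
    ∀ ε : ℝ, 0 < ε →
      ∃ ψ : ℝ → ℝ, ContDiff ℝ (⊤ : ℕ∞) ψ ∧
        (∀ ρ : ℝ, η ^ 2 ≤ ρ → ψ ρ = 0) ∧
        (∀ ρ : ℝ, 0 ≤ ρ → -1 ≤ deriv ψ ρ) ∧
        (∀ ρ : ℝ, 0 ≤ ρ → 0 ≤ deriv (deriv ψ) ρ) ∧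
        η ^ (2 * d + 2) - ε ≤
          ∫ r in (0:ℝ)..η,
            (1 - (1 + deriv ψ (r ^ 2)) ^ (d + 1)) * ((2 * d + 2) * r ^ (2 * d + 1)) := by
  intro ε hε
  obtain ⟨a, ha0, haη, ha⟩ : ∃ a : ℝ, 0 < a ∧ a < η ∧ η ^ (2 * d + 2) - ε ≤ a ^ (2 * d + 2) := by
    have hc : Filter.Tendsto (fun x : ℝ => x ^ (2 * d + 2)) (nhdsWithin η (Set.Iio η))
        (nhds (η ^ (2 * d + 2))) :=
      ((continuous_pow (2 * d + 2)).tendsto η).mono_left nhdsWithin_le_nhds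
    have h1 := hc.eventually (lt_mem_nhds (show η ^ (2 * d + 2) - ε < η ^ (2 * d + 2) by linarith))
    have h2 : ∀ᶠ x in nhdsWithin η (Set.Iio η), x ∈ Set.Ioo 0 η := Ioo_mem_nhdsLT hη
    obtain ⟨a, h3, h4⟩ := (h1.and h2).exists
    exact ⟨a, h4.1, h4.2, h3.le⟩
  have hδ : 0 < η ^ 2 - a ^ 2 := by nlinarith
  set δ := η ^ 2 - a ^ 2 with hδd
  set g : ℝ → ℝ := fun t => - Real.smoothTransition ((η ^ 2 - t) / δ) with hg
  have hgs : ContDiff ℝ (⊤ : ℕ∞) g := by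
    have h : ContDiff ℝ (⊤ : ℕ∞) (fun t : ℝ => (η ^ 2 - t) / δ) :=
      (contDiff_const.sub contDiff_id).div_const _
    exact (Real.smoothTransition.contDiff.comp h).neg
  have hgc : Continuous g := hgs.continuous
  have hgm : Monotone g := by
    intro x y hxy
    apply neg_le_neg
    apply Real.smoothTransition.monotone
    gcongr
  have hD : ∀ x, HasDerivAt (fun ρ => ∫ t in (η ^ 2)..ρ, g t) (g x) x := fun x =>
    intervalIntegral.integral_hasDerivAt_right (hgc.intervalIntegrable _ _)
      hgc.stronglyMeasurable.stronglyMeasurableAtFilter hgc.continuousAt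
  have hd : deriv (fun ρ => ∫ t in (η ^ 2)..ρ, g t) = g := funext fun x => (hD x).deriv
  have hg0 : ∀ x, g x ≤ 0 := fun x => neg_nonpos.2 (Real.smoothTransition.nonneg _)
  have hg1 : ∀ x, -1 ≤ g x := fun x => neg_le_neg (Real.smoothTransition.le_one _)
  refine ⟨fun ρ => ∫ t in (η ^ 2)..ρ, g t, ?_, ?_, ?_, ?_, ?_⟩
  · rw [contDiff_infty_iff_deriv, hd]
    exact ⟨fun x => (hD x).differentiableAt, hgs⟩
  · intro ρ hρ
    apply intervalIntegral.integral_zero_ae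
    refine Filter.Eventually.of_forall fun t ht => ?_
    rw [Set.uIoc_of_le hρ] at ht
    have : (η ^ 2 - t) / δ ≤ 0 := div_nonpos_of_nonpos_of_nonneg (by linarith [ht.1]) hδ.le
    simp [hg, Real.smoothTransition.zero_of_nonpos this]
  · intro ρ _
    rw [hd]
    exact hg1 ρ
  · intro ρ _
    rw [hd]
    exact hgm.deriv_nonneg
  · rw [hd]
    set F : ℝ → ℝ := fun r =>
      (1 - (1 + g (r ^ 2)) ^ (d + 1)) * ((2 * d + 2) * r ^ (2 * d + 1)) with hF
    have hFc : Continuous F := by fun_prop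
    have e1 : ∫ r in (0:ℝ)..a, F r = a ^ (2 * d + 2) := by
      have : ∫ r in (0:ℝ)..a, F r = ∫ r in (0:ℝ)..a, (2 * d + 2) * r ^ (2 * d + 1) := by
        apply intervalIntegral.integral_congr
        intro r hr
        rw [Set.uIcc_of_le ha0.le] at hr
        have h1 : 1 ≤ (η ^ 2 - r ^ 2) / δ := by
          rw [le_div_iff₀ hδ]
          nlinarith [hr.1, hr.2]
        simp [hF, hg, Real.smoothTransition.one_of_one_le h1]
      rw [this, intervalIntegral.integral_const_mul, integral_pow]
      have : (2 * (d:ℝ) + 2) ≠ 0 := by positivity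
      push_cast
      have h3 : (2 * (d:ℝ) + 1 + 1) ≠ 0 := by positivity
      field_simp
      ring
    have e2 : 0 ≤ ∫ r in a..η, F r := by
      apply intervalIntegral.integral_nonneg haη.le
      intro r hr
      have hr0 : 0 ≤ r := ha0.le.trans hr.1
      have : (1 + g (r ^ 2)) ^ (d + 1) ≤ 1 :=
        pow_le_one₀ (by linarith [hg1 (r ^ 2)]) (by linarith [hg0 (r ^ 2)])
      exact mul_nonneg (by linarith) (by positivity)
    have e3 := intervalIntegral.integral_add_adjacent_intervals
      (hFc.intervalIntegrable 0 a (μ := MeasureTheory.volume)) (hFc.intervalIntegrable a η)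
    linarith
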